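/- arXiv:1610.09475 — 2 statements merged into one kernel-verified Lean document; each statement's English description precedes it below -/
import Mathlib

section
/- Let n ≥ 3, ε ∈ {−1,1}^n, u ∈ ℂ and ℓ ∈ ℕ, and set μ := u − (n−1)/2 and v := u + ℓ. Then the symbol P^{ε,μ}_ℓ of the scalar Juhl operator is an (ε,u,v)-covariant symbol; that is, for every conformal Killing pair (Z,ρ) on ℝ^n with signature ε tangent to {x_n = 0}, every smooth f : ℝ^n → ℂ and every x ∈ ℝ^n with x_n = 0, one has 𝒟^μ_ℓ[ε](Σ_{j=1}^n Z_j ∂_j f + (u/2) ρ f)(x) = Σ_{j=1}^{n−1} Z_j(x) ∂_j(𝒟^μ_ℓ[ε] f)(x) + ((u+ℓ)/2) ρ(x) (𝒟^μ_ℓ[ε] f)(x). (Scalar case i = j = 0 of Theorems StageC and D: 𝒟^μ_ℓ is a conformal symmetry breaking operator from E^0(ℝ^{p,q})_u to E^0 of the hyperplane with parameter u+ℓ.) -/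
open scoped BigOperators

noncomputable section

def pd {n : ℕ} {E : Type} [NormedAddCommGroup E] [NormedSpace ℝ E]
    (j : Fin n) (f : (Fin n → ℝ) → E) : (Fin n → ℝ) → E :=
  fun x => fderiv ℝ f x (Pi.single j 1)

def akCoeff (μ : ℂ) (ℓ k : ℕ) : ℂ :=
  ((-1 : ℂ) ^ k * 2 ^ (ℓ - 2 * k) / (Nat.factorial k * Nat.factorial (ℓ - 2 * k))) *
    ∏ j ∈ Finset.Ico ((ℓ + 1) / 2) (ℓ - k), (μ + (j : ℂ))

def sLap {n : ℕ} (ε : Fin n → ℝ) (i₀ : Fin n) (f : (Fin n → ℝ) → ℂ) : (Fin n → ℝ) → ℂ :=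
  fun x => (-(ε i₀ : ℂ)) * ∑ j ∈ Finset.univ.erase i₀, (ε j : ℂ) * pd j (pd j f) x

def juhlOp {n : ℕ} (ε : Fin n → ℝ) (i₀ : Fin n) (μ : ℂ) (ℓ : ℕ)
    (f : (Fin n → ℝ) → ℂ) : (Fin n → ℝ) → ℂ :=
  fun x => ∑ k ∈ Finset.range (ℓ / 2 + 1),
    akCoeff μ ℓ k * ((sLap ε i₀)^[k] ((pd i₀)^[ℓ - 2 * k] f)) x

def juhlSymbol {n : ℕ} (ε : Fin n → ℝ) (i₀ : Fin n) (μ : ℂ) (ℓ : ℕ) :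
    MvPolynomial (Fin n) ℂ :=
  ∑ k ∈ Finset.range (ℓ / 2 + 1),
    MvPolynomial.C (akCoeff μ ℓ k) *
      (MvPolynomial.C (-(ε i₀ : ℂ)) *
        ∑ j ∈ Finset.univ.erase i₀, MvPolynomial.C ((ε j : ℂ)) * MvPolynomial.X j ^ 2) ^ k *
      MvPolynomial.X i₀ ^ (ℓ - 2 * k)

def monoDiff {n : ℕ} (m : Fin n → ℕ) (f : (Fin n → ℝ) → ℂ) : (Fin n → ℝ) → ℂ :=
  (List.finRange n).foldr (fun j g => (pd j)^[m j] g) f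

def polyDiff {n : ℕ} (P : MvPolynomial (Fin n) ℂ) (f : (Fin n → ℝ) → ℂ) :
    (Fin n → ℝ) → ℂ :=
  fun x => ∑ m ∈ P.support, P.coeff m * monoDiff (fun j => m j) f x

def IsConformalKillingPair {n : ℕ} (ε : Fin n → ℝ) (V : Set (Fin n → ℝ))
    (Z : (Fin n → ℝ) → (Fin n → ℝ)) (ρ : (Fin n → ℝ) → ℝ) : Prop :=
  ContDiffOn ℝ (⊤ : ℕ∞) Z V ∧ ContDiffOn ℝ (⊤ : ℕ∞) ρ V ∧
    ∀ i j : Fin n, ∀ x ∈ V,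
      ε i * pd j (fun y => Z y i) x + ε j * pd i (fun y => Z y j) x
        = ρ x * ε i * (if i = j then 1 else 0)

def IsCovariantSymbol {n : ℕ} (ε : Fin n → ℝ) (i₀ : Fin n) (u v : ℂ)
    (P : MvPolynomial (Fin n) ℂ) : Prop :=
  ∀ (Z : (Fin n → ℝ) → (Fin n → ℝ)) (ρ : (Fin n → ℝ) → ℝ),
    IsConformalKillingPair ε Set.univ Z ρ →
    (∀ x : Fin n → ℝ, x i₀ = 0 → Z x i₀ = 0) →
    ∀ f : (Fin n → ℝ) → ℂ, ContDiff ℝ (⊤ : ℕ∞) f →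
    ∀ x : Fin n → ℝ, x i₀ = 0 →
      polyDiff P (fun y => (∑ j, (Z y j : ℂ) * pd j f y) + u / 2 * (ρ y : ℂ) * f y) x
        = (∑ j ∈ Finset.univ.erase i₀, (Z x j : ℂ) * pd j (polyDiff P f) x)
          + v / 2 * (ρ x : ℂ) * polyDiff P f x


abbrev Sm {n : ℕ} {E : Type} [NormedAddCommGroup E] [NormedSpace ℝ E]
    (f : (Fin n → ℝ) → E) : Prop := ContDiff ℝ (⊤ : ℕ∞) f

section calculus
variable {n : ℕ} {E : Type} [NormedAddCommGroup E] [NormedSpace ℝ E]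

lemma Sm.diff {f : (Fin n → ℝ) → E} (hf : Sm f) (x) : DifferentiableAt ℝ f x :=
  (hf.differentiable (by simp)) x

lemma Sm.pd {f : (Fin n → ℝ) → E} (hf : Sm f) (j : Fin n) : Sm (pd j f) := by
  have h : ContDiff ℝ (⊤ : ℕ∞) (fderiv ℝ f) := hf.fderiv_right (by simp)
  exact h.clm_apply contDiff_const

lemma pd_comm {f : (Fin n → ℝ) → E} (hf : Sm f) (i j : Fin n) :
    pd i (pd j f) = pd j (pd i f) := by
  have h : ContDiff ℝ (⊤ : ℕ∞) (fderiv ℝ f) := hf.fderiv_right (by simp)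
  have key : ∀ (i j : Fin n) (x : Fin n → ℝ), pd i (pd j f) x
      = fderiv ℝ (fderiv ℝ f) x (Pi.single i 1) (Pi.single j 1) := by
    intro i j x
    have hd : DifferentiableAt ℝ (fderiv ℝ f) x := (h.differentiable (by simp)) x
    unfold pd
    rw [fderiv_clm_apply hd (differentiableAt_const _)]
    simp
  funext x
  rw [key, key]
  have := (hf.contDiffAt (x := x)).isSymmSndFDerivAt (by simp; exact WithTop.coe_le_coe.2 le_top)
  exact this.eq _ _

lemma pd_add {f g : (Fin n → ℝ) → E} (hf : Sm f) (hg : Sm g) (j : Fin n) :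
    pd j (fun y => f y + g y) = fun y => pd j f y + pd j g y := by
  funext x
  simp only [pd]
  rw [fderiv_fun_add (hf.diff x) (hg.diff x)]; rfl

lemma pd_const (c : E) (j : Fin n) : pd j (fun _ => c) = fun _ => 0 := by
  funext x; simp [pd]

lemma pd_sum {ι : Type} (s : Finset ι) {f : ι → (Fin n → ℝ) → E} (hf : ∀ i ∈ s, Sm (f i))
    (j : Fin n) :
    pd j (fun y => ∑ i ∈ s, f i y) = fun y => ∑ i ∈ s, pd j (f i) y := by
  funext x
  simp only [pd]
  rw [fderiv_fun_sum (fun i hi => (hf i hi).diff x)]; simp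

lemma pd_mulC {f g : (Fin n → ℝ) → ℂ} (hf : Sm f) (hg : Sm g) (j : Fin n) :
    pd j (fun y => f y * g y) = fun y => pd j f y * g y + f y * pd j g y := by
  funext x
  simp only [pd]
  rw [fderiv_fun_mul (hf.diff x) (hg.diff x)]; simp; ring

lemma pd_cmul {f : (Fin n → ℝ) → ℂ} (hf : Sm f) (c : ℂ) (j : Fin n) :
    pd j (fun y => c * f y) = fun y => c * pd j f y := by
  rw [pd_mulC contDiff_const hf]; simp [pd_const]

lemma pd_cmulR {f : (Fin n → ℝ) → ℝ} (hf : Sm f) (c : ℝ) (j : Fin n) :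
    pd j (fun y => c * f y) = fun y => c * pd j f y := by
  funext x
  simp only [pd]
  rw [fderiv_const_mul (hf.diff x)]; simp

lemma Sm.ofReal {f : (Fin n → ℝ) → ℝ} (hf : Sm f) : Sm (fun y => (f y : ℂ)) :=
  Complex.ofRealCLM.contDiff.comp hf

lemma pd_ofReal {f : (Fin n → ℝ) → ℝ} (hf : Sm f) (j : Fin n) :
    pd j (fun y => (f y : ℂ)) = fun y => ((pd j f y : ℝ) : ℂ) := by
  funext x
  simp only [pd]
  have := (Complex.ofRealCLM.hasFDerivAt (x := f x)).comp x (hf.diff x).hasFDerivAt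
  have h2 : fderiv ℝ (fun y => (f y : ℂ)) x = _ := this.fderiv
  rw [h2]; simp

/-- iterates -/
lemma Sm.iter {f : (Fin n → ℝ) → E} (hf : Sm f) (j : Fin n) (k : ℕ) : Sm ((_root_.pd j)^[k] f) := by
  induction k generalizing f with
  | zero => exact hf
  | succ k ih => exact ih (hf.pd j)

lemma pd_iter_comm {f : (Fin n → ℝ) → E} (hf : Sm f) (i j : Fin n) (k : ℕ) :
    (pd j)^[k] (pd i f) = pd i ((pd j)^[k] f) := by
  induction k generalizing f with
  | zero => rfl
  | succ k ih => 
    rw [Function.iterate_succ_apply, Function.iterate_succ_apply, pd_comm hf, ih (hf.pd j)]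

def lf (L : List (Fin n)) (m : Fin n → ℕ) (f : (Fin n → ℝ) → ℂ) : (Fin n → ℝ) → ℂ :=
  L.foldr (fun j g => (pd j)^[m j] g) f

lemma lf_sm (L : List (Fin n)) (m : Fin n → ℕ) {f : (Fin n → ℝ) → ℂ} (hf : Sm f) :
    Sm (lf L m f) := by
  induction L with
  | nil => exact hf
  | cons a L ih => exact ih.iter a _

lemma lf_pd (L : List (Fin n)) (m : Fin n → ℕ) {f : (Fin n → ℝ) → ℂ} (hf : Sm f) (j : Fin n) :
    lf L m (pd j f) = pd j (lf L m f) := by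
  induction L with
  | nil => rfl
  | cons a L ih =>
    change (pd a)^[m a] (lf L m (pd j f)) = pd j ((pd a)^[m a] (lf L m f))
    rw [ih, pd_iter_comm (lf_sm L m hf)]

lemma lf_succ_not (L : List (Fin n)) (m m' : Fin n → ℕ) {f : (Fin n → ℝ) → ℂ} (j : Fin n)
    (hm : ∀ i, i ≠ j → m' i = m i) (hj : j ∉ L) :
    lf L m' f = lf L m f := by
  induction L with
  | nil => rfl
  | cons a L ih =>
    simp only [List.mem_cons, not_or] at hj
    change (pd a)^[m' a] (lf L m' f) = ((pd a)^[m a] (lf L m f))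
    rw [ih hj.2, hm a (Ne.symm hj.1)]

lemma lf_succ (L : List (Fin n)) (m m' : Fin n → ℕ) {f : (Fin n → ℝ) → ℂ} (hf : Sm f) (j : Fin n)
    (hm : ∀ i, i ≠ j → m' i = m i) (hmj : m' j = m j + 1) (hj : j ∈ L) (hL : L.Nodup) :
    lf L m' f = pd j (lf L m f) := by
  induction L with
  | nil => simp at hj
  | cons a L ih =>
    change (pd a)^[m' a] (lf L m' f) = pd j ((pd a)^[m a] (lf L m f))
    rw [List.nodup_cons] at hL
    by_cases h : a = j
    · subst h
      rw [lf_succ_not L m m' a hm hL.1, hmj, Function.iterate_succ_apply', ]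
    · have : j ∈ L := by simpa [Ne.symm h] using hj
      rw [ih this hL.2, pd_iter_comm (lf_sm L m hf), hm a h]

lemma monoDiff_sm (m : Fin n → ℕ) {f : (Fin n → ℝ) → ℂ} (hf : Sm f) : Sm (monoDiff m f) :=
  lf_sm _ m hf

lemma monoDiff_pd (m : Fin n → ℕ) {f : (Fin n → ℝ) → ℂ} (hf : Sm f) (j : Fin n) :
    monoDiff m (pd j f) = pd j (monoDiff m f) := lf_pd _ m hf j

lemma monoDiff_succ (m m' : Fin n → ℕ) {f : (Fin n → ℝ) → ℂ} (hf : Sm f) (j : Fin n)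
    (hm : ∀ i, i ≠ j → m' i = m i) (hmj : m' j = m j + 1) :
    monoDiff m' f = pd j (monoDiff m f) :=
  lf_succ _ m m' hf j hm hmj (List.mem_finRange j) (List.nodup_finRange n)

lemma monoDiff_zero (f : (Fin n → ℝ) → ℂ) : monoDiff (fun j => (0 : Fin n →₀ ℕ) j) f = f := by
  change lf (List.finRange n) _ f = f
  generalize List.finRange n = L
  induction L with
  | nil => rfl
  | cons a L ih => exact ih

/-- The functional P ↦ P(∂) f (x). -/
def Lx (f : (Fin n → ℝ) → ℂ) (x : Fin n → ℝ) : MvPolynomial (Fin n) ℂ →ₗ[ℂ] ℂ :=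
  Finsupp.lsum ℂ (fun m : Fin n →₀ ℕ =>
    (LinearMap.lsmul ℂ ℂ).flip (monoDiff (fun j => m j) f x)) ∘ₗ
    (AddMonoidAlgebra.coeffLinearEquiv ℂ).toLinearMap

lemma Lx_eq (f : (Fin n → ℝ) → ℂ) (x : Fin n → ℝ) (P : MvPolynomial (Fin n) ℂ) :
    polyDiff P f x = Lx f x P := by
  rfl

lemma Lx_monomial (f : (Fin n → ℝ) → ℂ) (x : Fin n → ℝ) (m : Fin n →₀ ℕ) (c : ℂ) :
    Lx f x (MvPolynomial.monomial m c) = c * monoDiff (fun j => m j) f x := by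
  simp [Lx, MvPolynomial.monomial]

lemma Lx_C_mul (f : (Fin n → ℝ) → ℂ) (x : Fin n → ℝ) (c : ℂ) (P : MvPolynomial (Fin n) ℂ) :
    Lx f x (MvPolynomial.C c * P) = c * Lx f x P := by
  rw [← MvPolynomial.smul_eq_C_mul, map_smul, smul_eq_mul]

lemma Lx_mul_X {f : (Fin n → ℝ) → ℂ} (hf : Sm f) (x : Fin n → ℝ) (P : MvPolynomial (Fin n) ℂ)
    (j : Fin n) : Lx f x (P * MvPolynomial.X j) = Lx (pd j f) x P := by
  induction P using MvPolynomial.induction_on' with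
  | add p q hp hq => rw [add_mul, map_add, map_add, hp, hq]
  | monomial m c =>
    rw [MvPolynomial.X, MvPolynomial.monomial_mul, Lx_monomial, Lx_monomial, monoDiff_pd _ hf,
      mul_one]
    rw [monoDiff_succ (fun j => m j) _ hf j]
    · intro i hi; simp [Finsupp.single_apply, Ne.symm hi]
    · simp

lemma polyDiff_sm {f : (Fin n → ℝ) → ℂ} (hf : Sm f) (P : MvPolynomial (Fin n) ℂ) :
    Sm (polyDiff P f) :=
  ContDiff.sum fun m _ => contDiff_const.mul (monoDiff_sm _ hf)

lemma pd_polyDiff {f : (Fin n → ℝ) → ℂ} (hf : Sm f) (P : MvPolynomial (Fin n) ℂ) (j : Fin n)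
    (x) : pd j (polyDiff P f) x = Lx f x (P * MvPolynomial.X j) := by
  rw [Lx_mul_X hf, ← Lx_eq]
  unfold polyDiff
  rw [pd_sum _ (fun m _ => contDiff_const.mul (monoDiff_sm _ hf))]
  refine Finset.sum_congr rfl fun m _ => ?_
  rw [pd_cmul (monoDiff_sm _ hf), monoDiff_pd _ hf]

lemma Lx_add {f g : (Fin n → ℝ) → ℂ} (hf : Sm f) (hg : Sm g) (x) (P : MvPolynomial (Fin n) ℂ) :
    Lx (fun y => f y + g y) x P = Lx f x P + Lx g x P := by
  induction P using MvPolynomial.induction_on generalizing f g with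
  | C a =>
    have := fun f : (Fin n → ℝ) → ℂ => Lx_monomial f x 0 a
    simp only [monoDiff_zero, MvPolynomial.monomial_zero'] at this
    rw [this, this, this]; ring
  | add p q hp hq => simp only [map_add, hp hf hg, hq hf hg]; ring
  | mul_X p j hp =>
    rw [Lx_mul_X hf, Lx_mul_X hg, Lx_mul_X (hf.add hg), pd_add hf hg, hp (hf.pd j) (hg.pd j)]

lemma Lx_C {f : (Fin n → ℝ) → ℂ} (x) (a : ℂ) : Lx f x (MvPolynomial.C a) = a * f x := by
  have := Lx_monomial f x 0 a
  simpa only [monoDiff_zero, MvPolynomial.monomial_zero'] using this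

lemma Lx_sum {ι : Type} (s : Finset ι) {f : ι → (Fin n → ℝ) → ℂ} (hf : ∀ i ∈ s, Sm (f i)) (x)
    (P : MvPolynomial (Fin n) ℂ) :
    Lx (fun y => ∑ i ∈ s, f i y) x P = ∑ i ∈ s, Lx (f i) x P := by
  induction P using MvPolynomial.induction_on generalizing f with
  | C a => simp only [Lx_C, Finset.mul_sum]
  | add p q hp hq => simp only [map_add, hp hf, hq hf, Finset.sum_add_distrib]
  | mul_X p j hp =>
    rw [Lx_mul_X (ContDiff.sum hf), pd_sum s hf, hp (fun i hi => (hf i hi).pd j)]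
    exact Finset.sum_congr rfl fun i hi => (Lx_mul_X (hf i hi) x p j).symm

lemma Lx_cmul {f : (Fin n → ℝ) → ℂ} (hf : Sm f) (c : ℂ) (x) (P : MvPolynomial (Fin n) ℂ) :
    Lx (fun y => c * f y) x P = c * Lx f x P := by
  induction P using MvPolynomial.induction_on generalizing f with
  | C a => simp only [Lx_C]; ring
  | add p q hp hq => simp only [map_add, hp hf, hq hf]; ring
  | mul_X p j hp =>
    rw [Lx_mul_X (contDiff_const.mul hf), Lx_mul_X hf, pd_cmul hf, hp (hf.pd j)]

open MvPolynomial in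
/-- Leibniz rule for quadratic multipliers. -/
lemma leibniz (P : MvPolynomial (Fin n) ℂ) {q g : (Fin n → ℝ) → ℂ} (hq : Sm q) (hg : Sm g)
    (h3 : ∀ i j k, pd i (pd j (pd k q)) = fun _ => 0) (x) :
    Lx (fun y => q y * g y) x P = q x * Lx g x P + ∑ i, pd i q x * Lx g x (pderiv i P)
      + (1 / 2) * ∑ i, ∑ k, pd i (pd k q) x * Lx g x (pderiv i (pderiv k P)) := by
  induction P using MvPolynomial.induction_on generalizing q g with
  | C a => simp [Lx_C]; ring
  | add p r hp hr =>
    rw [map_add, hp hq hg h3, hr hq hg h3]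
    simp only [map_add, mul_add, Finset.sum_add_distrib]; ring
  | mul_X p j hp =>
    rw [Lx_mul_X (hq.mul hg), pd_mulC hq hg, Lx_add ((hq.pd j).mul hg) (hq.mul (hg.pd j)),
      hp (hq.pd j) hg, hp hq (hg.pd j) h3]
    · have e1 : ∀ i k, pd i (pd k (pd j q)) x = 0 := fun i k => by rw [h3]
      simp only [e1, zero_mul, Finset.sum_const_zero, mul_zero, add_zero, Derivation.leibniz,
        pderiv_X, smul_eq_mul, map_add, mul_add, Finset.sum_add_distrib]
      have e2 : ∀ i, Lx g x (X j * pderiv i p) = Lx (pd j g) x (pderiv i p) := fun i => by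
        rw [mul_comm, Lx_mul_X hg]
      have e3 : ∀ i k, Lx g x (X j * pderiv i (pderiv k p)) = Lx (pd j g) x (pderiv i (pderiv k p))
        := fun i k => by rw [mul_comm, Lx_mul_X hg]
      have e4 : ∀ i (r : MvPolynomial (Fin n) ℂ), Lx g x (r * (Pi.single i 1 : Fin n → MvPolynomial (Fin n) ℂ) j) =
        if i = j then Lx g x r else 0 := fun i r => by
        by_cases h : i = j
        · subst h; simp
        · simp [h, Ne.symm h]
      have e4' : ∀ i (r : MvPolynomial (Fin n) ℂ), Lx g x ((Pi.single i 1 : Fin n → MvPolynomial (Fin n) ℂ) j * r) =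
        if i = j then Lx g x r else 0 := fun i r => by rw [mul_comm, e4]
      have e5 : ∀ i k, Lx g x (p * pderiv i ((Pi.single k 1 : Fin n → MvPolynomial (Fin n) ℂ) j)) = 0 := fun i k => by
        by_cases h : k = j
        · subst h; simp
        · simp [h, Ne.symm h]
      simp only [e2, e3, e4, e4', e5, Lx_mul_X hg, mul_ite, mul_zero, Finset.sum_ite_eq', Finset.sum_ite_eq,
        Finset.mem_univ, if_true, add_zero, Finset.sum_const_zero, zero_add]
      have e6 : ∀ i, pd i (pd j q) x = pd j (pd i q) x := fun i => by rw [pd_comm hq]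
      have e7 : (∑ i, ∑ k, if i = j then pd i (pd k q) x * Lx g x (pderiv k p) else 0)
        = ∑ k, pd j (pd k q) x * Lx g x (pderiv k p) := by
        rw [Finset.sum_eq_single j]
        · simp
        · intro b _ hb; simp [hb]
        · simp
      simp only [e6, e7]
      ring
    · intro i k l
      rw [h3]
      exact pd_const _ _ 
end calculus

section symbolalg
open MvPolynomial
variable {n : ℕ}

lemma pderiv_swap (i j : Fin n) (P : MvPolynomial (Fin n) ℂ) :
    pderiv i (pderiv j P) = pderiv j (pderiv i P) := by
  induction P using MvPolynomial.induction_on with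
  | C a => simp
  | add p q hp hq => simp [hp, hq]
  | mul_X p k hp =>
    simp only [Derivation.leibniz, pderiv_X, smul_eq_mul, map_add, hp]
    have : ∀ a b : Fin n, pderiv a ((Pi.single b 1 : Fin n → MvPolynomial (Fin n) ℂ) k) = 0 := by
      intro a b
      by_cases h : b = k
      · subst h; simp
      · simp [Ne.symm h]
    simp only [this]; ring

def RR (ε : Fin n → ℝ) (i₀ : Fin n) : MvPolynomial (Fin n) ℂ :=
  C (-(ε i₀ : ℂ)) * ∑ j ∈ Finset.univ.erase i₀, C ((ε j : ℂ)) * X j ^ 2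

lemma pderiv_RR (ε : Fin n → ℝ) (i₀ i : Fin n) (h : i ≠ i₀) :
    pderiv i (RR ε i₀) = C (-2 * (ε i₀ : ℂ) * ε i) * X i := by
  unfold RR
  rw [pderiv_C_mul, map_sum]
  rw [Finset.sum_eq_single i]
  · rw [pderiv_C_mul, Derivation.leibniz_pow, pderiv_X_self]
    have h2 : (C 2 : MvPolynomial (Fin n) ℂ) = 2 := rfl
    simp [h2]; ring
  · intro b _ hb
    rw [pderiv_C_mul, Derivation.leibniz_pow, pderiv_X_of_ne hb]; simp
  · intro hh; simp [h] at hh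

lemma pderiv_RR0 (ε : Fin n → ℝ) (i₀ : Fin n) :
    pderiv i₀ (RR ε i₀) = 0 := by
  unfold RR
  rw [pderiv_C_mul, map_sum, Finset.sum_eq_zero, mul_zero]
  intro b hb
  rw [pderiv_C_mul, Derivation.leibniz_pow, pderiv_X_of_ne (Finset.ne_of_mem_erase hb)]; simp

lemma pderiv_term (ε : Fin n → ℝ) (i₀ i : Fin n) (h : i ≠ i₀) (c : ℂ) (k m : ℕ) :
    pderiv i (C c * RR ε i₀ ^ k * X i₀ ^ m) =
      C (-2 * (ε i₀ : ℂ) * ε i) * X i * (C (c * k) * RR ε i₀ ^ (k - 1) * X i₀ ^ m) := by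
  rw [mul_assoc, pderiv_C_mul, Derivation.leibniz, Derivation.leibniz_pow, Derivation.leibniz_pow,
    pderiv_RR ε i₀ i h, pderiv_X_of_ne (Ne.symm h)]
  simp; ring

lemma pderiv_term0 (ε : Fin n → ℝ) (i₀ : Fin n) (c : ℂ) (k m : ℕ) :
    pderiv i₀ (C c * RR ε i₀ ^ k * X i₀ ^ m) =
       (C (c * m) * RR ε i₀ ^ k * X i₀ ^ (m - 1)) := by
  rw [mul_assoc, pderiv_C_mul, Derivation.leibniz, Derivation.leibniz_pow, Derivation.leibniz_pow,
    pderiv_RR0 ε i₀, pderiv_X_self]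
  simp; ring

def QQ (ε : Fin n → ℝ) (i₀ : Fin n) (N : ℕ) (c : ℕ → ℂ) (e d : ℕ → ℕ) : MvPolynomial (Fin n) ℂ :=
  ∑ k ∈ Finset.range N, C (c k) * RR ε i₀ ^ e k * X i₀ ^ d k

lemma pderiv_QQ (ε : Fin n → ℝ) (i₀ i : Fin n) (h : i ≠ i₀) (N c e d) :
    pderiv i (QQ ε i₀ N c e d) = C (-2 * (ε i₀ : ℂ) * ε i) * X i *
      QQ ε i₀ N (fun k => c k * e k) (fun k => e k - 1) d := by
  simp only [QQ, map_sum, pderiv_term ε i₀ i h, Finset.mul_sum]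

lemma pderiv_QQ0 (ε : Fin n → ℝ) (i₀ : Fin n) (N c e d) :
    pderiv i₀ (QQ ε i₀ N c e d) = 
      QQ ε i₀ N (fun k => c k * d k) e (fun k => d k - 1) := by
  simp only [QQ, map_sum, pderiv_term0 ε i₀]

lemma symbol_QQ (ε : Fin n → ℝ) (i₀ : Fin n) (μ : ℂ) (ℓ : ℕ) :
    juhlSymbol ε i₀ μ ℓ = QQ ε i₀ (ℓ / 2 + 1) (akCoeff μ ℓ) id (fun k => ℓ - 2 * k) := rfl

lemma ak_rec (μ : ℂ) (ℓ k : ℕ) (hk : k + 1 ≤ ℓ / 2) :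
    akCoeff μ ℓ k * ((ℓ - 2 * k : ℕ) : ℂ) * ((ℓ - 2 * k - 1 : ℕ) : ℂ) =
      -4 * (μ + ℓ - 1 - k) * (akCoeff μ ℓ (k + 1) * ((k + 1 : ℕ) : ℂ)) := by
  unfold akCoeff
  obtain ⟨m, hm⟩ : ∃ m, ℓ = 2 * k + 2 + m := ⟨ℓ - 2 * k - 2, by omega⟩
  have h1 : ℓ - 2 * k = m + 2 := by omega
  have h2 : ℓ - 2 * (k + 1) = m := by omega
  have h3 : ℓ - k = (ℓ - (k + 1)) + 1 := by omega
  have h4 : (ℓ + 1) / 2 ≤ ℓ - (k + 1) := by omega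
  rw [h1, h2, h3, Finset.prod_Ico_succ_top h4]
  have h5 : ((ℓ - (k + 1) : ℕ) : ℂ) = ℓ - 1 - k := by
    rw [Nat.cast_sub (by omega)]; push_cast; ring
  rw [h5]
  generalize ∏ j ∈ Finset.Ico ((ℓ + 1) / 2) (ℓ - (k + 1)), (μ + (j : ℂ)) = W
  rw [Nat.factorial_succ (m + 1), Nat.factorial_succ m, Nat.factorial_succ k]
  have : m + 2 - 1 = m + 1 := rfl
  rw [this]
  push_cast
  have a1 : ((m : ℂ) + 1 + 1) ≠ 0 := by exact_mod_cast Nat.succ_ne_zero (m + 1)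
  have a2 : ((m : ℂ) + 1) ≠ 0 := Nat.cast_add_one_ne_zero m
  have a3 : ((k : ℂ) + 1) ≠ 0 := Nat.cast_add_one_ne_zero k
  have a4 : (m.factorial : ℂ) ≠ 0 := by exact_mod_cast m.factorial_ne_zero
  have a5 : (k.factorial : ℂ) ≠ 0 := by exact_mod_cast k.factorial_ne_zero
  field_simp
  ring

/-- Gegenbauer equation -/
lemma gegen (ε : Fin n → ℝ) (i₀ : Fin n) (μ : ℂ) (ℓ : ℕ) :
    QQ ε i₀ (ℓ / 2 + 1) (fun k => akCoeff μ ℓ k * ((ℓ - 2 * k : ℕ) : ℂ) * ((ℓ - 2 * k - 1 : ℕ) : ℂ))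
      id (fun k => ℓ - 2 * k - 1 - 1) =
    C 4 * RR ε i₀ * QQ ε i₀ (ℓ / 2 + 1) (fun k => akCoeff μ ℓ k * (k : ℂ) * ((k - 1 : ℕ) : ℂ))
      (fun k => k - 1 - 1) (fun k => ℓ - 2 * k)
    - C (4 * (ℓ - 1 + μ)) * QQ ε i₀ (ℓ / 2 + 1) (fun k => akCoeff μ ℓ k * (k : ℂ))
      (fun k => k - 1) (fun k => ℓ - 2 * k) := by
  unfold QQ
  rw [Finset.sum_range_succ, Finset.sum_range_succ' (n := ℓ / 2), Finset.sum_range_succ' (n := ℓ / 2)]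
  have hz : ((ℓ - 2 * (ℓ / 2) : ℕ) : ℂ) * ((ℓ - 2 * (ℓ / 2) - 1 : ℕ) : ℂ) = 0 := by
    rcases Nat.mod_two_eq_zero_or_one ℓ with h | h
    · have : ℓ - 2 * (ℓ / 2) = 0 := by omega
      simp [this]
    · have : ℓ - 2 * (ℓ / 2) = 1 := by omega
      simp [this]
  beta_reduce
  rw [mul_assoc (akCoeff μ ℓ (ℓ / 2)), hz]
  simp only [mul_zero, C_0, zero_mul, add_zero, Nat.cast_zero, Finset.mul_sum]
  rw [← Finset.sum_sub_distrib]
  refine Finset.sum_congr rfl fun k hk => ?_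
  rw [Finset.mem_range] at hk
  rw [ak_rec μ ℓ k hk]
  have h1 : ℓ - 2 * k - 1 - 1 = ℓ - 2 * (k + 1) := by omega
  rw [h1]
  simp only [id, Nat.add_sub_cancel]
  cases k with
  | zero => simp; ring
  | succ k =>
    simp only [Nat.add_sub_cancel, pow_succ]
    simp only [C_mul, C_add, C_sub, C_neg, C_1, Nat.cast_add, Nat.cast_one]
    ring

lemma box (ε : Fin n → ℝ) (hε : ∀ j, (ε j : ℂ) * ε j = 1) (i₀ : Fin n) (u : ℂ) (ℓ : ℕ) (P)
    (hP : P = juhlSymbol ε i₀ (u - ((n : ℂ) - 1) / 2) ℓ) (k : Fin n) (hk : k ≠ i₀) :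
    C (2 * (ℓ - 1) + 2 * u) * pderiv k P =
      C (ε k : ℂ) * X k * ∑ j, C (ε j : ℂ) * pderiv j (pderiv j P) := by
  subst hP
  set μ : ℂ := u - ((n : ℂ) - 1) / 2 with hμ
  rw [symbol_QQ, ← Finset.add_sum_erase _ _ (Finset.mem_univ i₀)]
  have e1 : ∑ j ∈ Finset.univ.erase i₀, C (ε j : ℂ) * pderiv j (pderiv j
      (QQ ε i₀ (ℓ / 2 + 1) (akCoeff μ ℓ) id (fun k => ℓ - 2 * k))) =
      ∑ j ∈ Finset.univ.erase i₀, (C (-2 * (ε i₀ : ℂ)) * 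
        QQ ε i₀ (ℓ / 2 + 1) (fun k => akCoeff μ ℓ k * (k : ℂ))
      (fun k => k - 1) (fun k => ℓ - 2 * k) + 
      C 4 * (C (ε j : ℂ) * X j ^ 2) * QQ ε i₀ (ℓ / 2 + 1) (fun k => akCoeff μ ℓ k * (k : ℂ) * ((k - 1 : ℕ) : ℂ))
      (fun k => k - 1 - 1) (fun k => ℓ - 2 * k)) := by
    refine Finset.sum_congr rfl fun j hj => ?_
    have hj' := Finset.ne_of_mem_erase hj
    rw [pderiv_QQ ε i₀ j hj', mul_assoc, pderiv_C_mul, Derivation.leibniz, pderiv_QQ ε i₀ j hj',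
      pderiv_X_self]
    simp only [smul_eq_mul, id]
    have h1 : (C (ε j : ℂ) * C (ε j : ℂ) : MvPolynomial (Fin n) ℂ) = 1 := by rw [← C_mul, hε, C_1]
    have h0 : (C (ε i₀ : ℂ) * C (ε i₀ : ℂ) : MvPolynomial (Fin n) ℂ) = 1 := by rw [← C_mul, hε, C_1]
    have h4 : (C 4 : MvPolynomial (Fin n) ℂ) = C (-2) * C (-2) := by rw [← C_mul]; norm_num
    simp only [C_mul, h4]
    linear_combination (exp := 1) 
      (C (-2) * C (ε i₀ : ℂ) * QQ ε i₀ (ℓ / 2 + 1) (fun k => akCoeff μ ℓ k * (k : ℂ))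
      (fun k => k - 1) (fun k => ℓ - 2 * k) + C (ε i₀ : ℂ) * C (ε i₀ : ℂ) * C (-2) * C (-2) * C (ε j : ℂ) * X j ^ 2 * QQ ε i₀ (ℓ / 2 + 1) (fun k => akCoeff μ ℓ k * (k : ℂ) * ((k - 1 : ℕ) : ℂ))
      (fun k => k - 1 - 1) (fun k => ℓ - 2 * k)) * h1 + C (-2) * C (-2) * C (ε j : ℂ) * X j ^ 2 * QQ ε i₀ (ℓ / 2 + 1) (fun k => akCoeff μ ℓ k * (k : ℂ) * ((k - 1 : ℕ) : ℂ))
      (fun k => k - 1 - 1) (fun k => ℓ - 2 * k) * h0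
  rw [e1, Finset.sum_add_distrib, Finset.sum_const, ← Finset.sum_mul, ← Finset.mul_sum,
    Finset.card_erase_of_mem (Finset.mem_univ _), Finset.card_univ, Fintype.card_fin,
    pderiv_QQ0, pderiv_QQ0, pderiv_QQ ε i₀ k hk]
  have g := gegen ε i₀ μ ℓ
  simp only [id] at g ⊢
  rw [g]
  have h0 : (C (ε i₀ : ℂ) * C (ε i₀ : ℂ) : MvPolynomial (Fin n) ℂ) = 1 := by rw [← C_mul, hε, C_1]
  have hR : ∑ j ∈ Finset.univ.erase i₀, C ((ε j : ℂ)) * X j ^ 2 = - C (ε i₀ : ℂ) * RR ε i₀ := by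
    unfold RR
    rw [C_neg]
    linear_combination (-(∑ j ∈ Finset.univ.erase i₀, C ((ε j : ℂ)) * X j ^ 2)) * h0
  rw [hR]
  have hn : ((n - 1 : ℕ) : MvPolynomial (Fin n) ℂ) = C ((n : ℂ) - 1) := by
    rw [← Nat.cast_pred (R := ℂ) (by have := i₀.2; omega)]; simp
  rw [nsmul_eq_mul, hn]
  have hu : u = μ + ((n : ℂ) - 1) * (1 / 2) := by rw [hμ]; ring
  rw [hu]
  have h2 : (C (1 / 2) : MvPolynomial (Fin n) ℂ) * C 2 = 1 := by rw [← C_mul]; norm_num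
  have h4 : (C 4 : MvPolynomial (Fin n) ℂ) = C 2 * C 2 := by rw [← C_mul]; norm_num
  simp only [C_mul, C_add, C_sub, C_neg, C_1, h4]
  generalize QQ ε i₀ (ℓ / 2 + 1) (fun k => akCoeff μ ℓ k * (k : ℂ))
      (fun k => k - 1) (fun k => ℓ - 2 * k) = A
  generalize QQ ε i₀ (ℓ / 2 + 1) (fun k => akCoeff μ ℓ k * (k : ℂ) * ((k - 1 : ℕ) : ℂ))
      (fun k => k - 1 - 1) (fun k => ℓ - 2 * k) = B
  linear_combination (-(C 2 * C (n : ℂ) - C 2) * C (ε i₀ : ℂ) * C (ε k : ℂ) * X k * A) * h2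

lemma symbol_hom (ε : Fin n → ℝ) (i₀ : Fin n) (μ : ℂ) (ℓ : ℕ) :
    (juhlSymbol ε i₀ μ ℓ).IsHomogeneous ℓ := by
  rw [symbol_QQ]
  refine IsHomogeneous.sum _ _ _ fun k hk => ?_
  rw [Finset.mem_range] at hk
  have hR : (RR ε i₀).IsHomogeneous 2 := by
    unfold RR
    have := (isHomogeneous_C (Fin n) (-(ε i₀ : ℂ))).mul (IsHomogeneous.sum (Finset.univ.erase i₀)
      (fun j => C ((ε j : ℂ)) * X j ^ 2) 2 (fun j _ => by
        simpa using (isHomogeneous_C (Fin n) (ε j : ℂ)).mul ((isHomogeneous_X ℂ j).pow 2)))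
    simpa using this
  have := ((isHomogeneous_C (Fin n) (akCoeff μ ℓ k)).mul (hR.pow k)).mul
    ((isHomogeneous_X ℂ i₀).pow (ℓ - 2 * k))
  have e : 0 + 2 * k + 1 * (ℓ - 2 * k) = ℓ := by omega
  rw [e] at this
  exact this

lemma euler1 (ε : Fin n → ℝ) (i₀ : Fin n) (μ : ℂ) (ℓ : ℕ) (P) (hP : P = juhlSymbol ε i₀ μ ℓ) :
    ∑ j, X j * pderiv j P = C (ℓ : ℂ) * P := by
  subst hP
  have := (symbol_hom ε i₀ μ ℓ).sum_X_mul_pderiv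
  rw [this]; simp

lemma euler2 (ε : Fin n → ℝ) (i₀ : Fin n) (μ : ℂ) (ℓ : ℕ) (P) (hP : P = juhlSymbol ε i₀ μ ℓ)
    (k : Fin n) :
    ∑ j, X j * pderiv k (pderiv j P) = C ((ℓ : ℂ) - 1) * pderiv k P := by
  have h := congrArg (pderiv k) (euler1 ε i₀ μ ℓ P hP)
  rw [map_sum, pderiv_C_mul] at h
  simp only [Derivation.leibniz, pderiv_X, smul_eq_mul, Finset.sum_add_distrib] at h
  rw [Finset.sum_eq_single (a := k) (f := fun x => pderiv x P * _)] at h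
  · rw [C_sub, C_1, sub_mul, ← h]; simp
  · intro b _ hb; simp [hb]
  · simp

/-- first order part -/
lemma partI (ε : Fin n → ℝ) (hε : ∀ j, (ε j : ℂ) * ε j = 1) (i₀ : Fin n) (μ : ℂ) (ℓ : ℕ) (P)
    (hP : P = juhlSymbol ε i₀ μ ℓ) (z : Fin n → Fin n → ℂ) (r : ℂ)
    (hz : ∀ i j, (ε i : ℂ) * z i j + ε j * z j i = r * ε i * (if i = j then 1 else 0))
    (h0 : ∀ i, i ≠ i₀ → z i₀ i = 0) :
    ∑ j, ∑ i, C (z j i) * (pderiv i P * X j) = C (ℓ / 2 * r) * P := by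
  have hsymm : ∀ i, i ≠ i₀ → z i i₀ = 0 := by
    intro i hi
    have := hz i i₀
    rw [h0 i hi, if_neg hi] at this
    have h1 := hε i
    linear_combination ε i * this - z i i₀ * h1
  have hdiag : ∀ i, z i i = r / 2 := by
    intro i
    have := hz i i
    rw [if_pos rfl] at this
    have h1 := hε i
    linear_combination ε i / 2 * this + (r/2 - z i i ) * h1
  -- the antisymmetric part
  have key : ∑ j, ∑ i, C (z j i - if i = j then r / 2 else 0) * (pderiv i P * X j) = 0 := by
    have hanti : ∀ F : Fin n → Fin n → MvPolynomial (Fin n) ℂ, (∀ i j, F i j = - F j i) →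
        ∑ j, ∑ i, F j i = 0 := by
      intro F hF
      have h1 : ∑ j, ∑ i, F j i = - ∑ j, ∑ i, F j i := by
        conv_lhs => rw [Finset.sum_comm]
        simp only [← Finset.sum_neg_distrib]
        exact Finset.sum_congr rfl fun j _ => Finset.sum_congr rfl fun i _ => hF i j
      exact self_eq_neg.mp h1
    apply hanti
    intro i j
    by_cases hij : i = j
    · subst hij; simp [hdiag]
    · have hij' : j ≠ i := Ne.symm hij
      rw [if_neg hij, if_neg hij', sub_zero, sub_zero]
      by_cases hi : i = i₀
      · subst hi; rw [h0 j hij', hsymm j hij']; simp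
      · by_cases hj : j = i₀
        · subst hj; rw [h0 i hij, hsymm i hij]; simp
        · subst hP
          rw [symbol_QQ, pderiv_QQ ε i₀ i hi, pderiv_QQ ε i₀ j hj]
          have h := hz i j
          rw [if_neg hij] at h
          have hi2 := hε i
          have hj2 := hε j
          have h' : z i j * ε j + z j i * ε i = 0 := by
            linear_combination ε i * ε j * h - z i j * ε j * hi2 - z j i * ε i * hj2
          have h'' : (C (z i j) * C (ε j : ℂ) + C (z j i) * C (ε i : ℂ) : MvPolynomial (Fin n) ℂ) = 0 := by
            rw [← C_mul, ← C_mul, ← C_add, h', C_0]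
          simp only [C_mul]
          linear_combination (C (-2) * C (ε i₀ : ℂ) * X i * X j * QQ ε i₀ (ℓ / 2 + 1) (fun k => akCoeff μ ℓ k * (id k : ℕ))
            (fun k => id k - 1) (fun k => ℓ - 2 * k)) * h''
  have e := euler1 ε i₀ μ ℓ P hP
  simp only [C_sub, sub_mul, Finset.sum_sub_distrib] at key
  rw [sub_eq_zero] at key
  rw [key]
  have : ∀ j, ∑ i, C (if i = j then r / 2 else 0) * (pderiv i P * X j) = C (r/2) * (X j * pderiv j P) := by
    intro j
    rw [Finset.sum_eq_single j]
    · rw [if_pos rfl]; ring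
    · intro b _ hb; simp [hb]
    · simp
  simp only [this]
  rw [← Finset.mul_sum, e, ← mul_assoc, ← C_mul]
  congr 2; ring

/-- second order part -/
lemma partII (ε : Fin n → ℝ) (hε : ∀ j, (ε j : ℂ) * ε j = 1) (i₀ : Fin n) (u : ℂ) (ℓ : ℕ) (P)
    (hP : P = juhlSymbol ε i₀ (u - ((n : ℂ) - 1) / 2) ℓ) (z : Fin n → Fin n → Fin n → ℂ)
    (b : Fin n → ℂ) (hb : b i₀ = 0)
    (hz : ∀ j i k, z j i k = 1 / 2 * ((if j = k then b i else 0) + (if j = i then b k else 0)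
      - (if k = i then ε j * ε k * b j else 0))) :
    C (1 / 2) * ∑ j, ∑ i, ∑ k, C (z j i k) * (pderiv i (pderiv k P) * X j)
      + C (u / 2) * ∑ i, C (b i) * pderiv i P = 0 := by
  have e2 := euler2 ε i₀ _ ℓ P hP
  have hbx := box ε hε i₀ u ℓ P hP
  have s1 : ∑ j, ∑ i, ∑ k, C (if j = k then b i else 0) * (pderiv i (pderiv k P) * X j) =
      ∑ i, C (b i) * (C ((ℓ : ℂ) - 1) * pderiv i P) := by
    rw [Finset.sum_comm]
    refine Finset.sum_congr rfl fun i _ => ?_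
    rw [← e2 i, Finset.mul_sum]
    refine Finset.sum_congr rfl fun j _ => ?_
    rw [Finset.sum_eq_single j]
    · rw [if_pos rfl]; ring
    · intro k _ hk; simp [Ne.symm hk]
    · simp
  have s2 : ∑ j, ∑ i, ∑ k, C (if j = i then b k else 0) * (pderiv i (pderiv k P) * X j) =
      ∑ i, C (b i) * (C ((ℓ : ℂ) - 1) * pderiv i P) := by
    rw [← s1]
    refine Finset.sum_congr rfl fun j _ => ?_
    rw [Finset.sum_comm]
    refine Finset.sum_congr rfl fun i _ => Finset.sum_congr rfl fun k _ => ?_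
    rw [pderiv_swap]
  have s3 : ∑ j, ∑ i, ∑ k, C (if k = i then ε j * ε k * b j else 0) * (pderiv i (pderiv k P) * X j) =
      ∑ i, C (b i) * (C (2 * (ℓ - 1) + 2 * u) * pderiv i P) := by
    refine Finset.sum_congr rfl fun j _ => ?_
    by_cases hj : j = i₀
    · subst hj; simp [hb]
    · rw [hbx j hj, Finset.mul_sum, Finset.mul_sum]
      refine Finset.sum_congr rfl fun i _ => ?_
      rw [Finset.sum_eq_single i]
      · simp only [if_true, C_mul]; ring
      · intro k _ hk; simp [hk]
      · simp
  have s : ∑ j, ∑ i, ∑ k, C (z j i k) * (pderiv i (pderiv k P) * X j) =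
     C (1 / 2) * (∑ i, C (b i) * (C ((ℓ : ℂ) - 1) * pderiv i P) + ∑ i, C (b i) * (C ((ℓ : ℂ) - 1) * pderiv i P)
      - ∑ i, C (b i) * (C (2 * (ℓ - 1) + 2 * u) * pderiv i P)) := by
    have s12 : ∀ A B D E : MvPolynomial (Fin n) ℂ, A = E → B = E →
      C (1 / 2) * (E + E - D) = C (1 / 2) * (A + B - D) := fun A B D E h h' => by rw [h, h']
    rw [← s3, s12 _ _ _ _ s1 s2]
    rw [← Finset.sum_add_distrib, ← Finset.sum_sub_distrib, Finset.mul_sum]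
    refine Finset.sum_congr rfl fun j _ => ?_
    rw [← Finset.sum_add_distrib, ← Finset.sum_sub_distrib, Finset.mul_sum]
    refine Finset.sum_congr rfl fun i _ => ?_
    rw [← Finset.sum_add_distrib, ← Finset.sum_sub_distrib, Finset.mul_sum]
    refine Finset.sum_congr rfl fun k _ => ?_
    rw [hz, C_mul, C_sub, C_add]; ring
  have t : ∀ c : ℂ, ∑ i, C (b i) * (C c * pderiv i P) = C c * ∑ i, C (b i) * pderiv i P := by
    intro c
    rw [Finset.mul_sum]
    exact Finset.sum_congr rfl fun i _ => by ring
  rw [s, t, t]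
  generalize ∑ i, C (b i) * pderiv i P = S
  have : (C (1/2) * (C (1/2) * (C ((ℓ:ℂ) - 1) + C ((ℓ:ℂ) - 1) - C (2 * (ℓ - 1) + 2 * u))) + C (u / 2) : MvPolynomial (Fin n) ℂ) = 0 := by
    rw [← C_add, ← C_sub, ← C_mul, ← C_mul, ← C_add]
    convert C_0 using 2
    ring
  linear_combination S * this
end symbolalg

section killing
variable {n : ℕ}

lemma kill2 (ε : Fin n → ℝ) (hε : ∀ j, ε j * ε j = 1) (z : Fin n → (Fin n → ℝ) → ℝ)
    (ρ : (Fin n → ℝ) → ℝ) (hz : ∀ i, Sm (z i)) (hρ : Sm ρ)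
    (hK : ∀ i j x, ε i * pd j (z i) x + ε j * pd i (z j) x
        = ρ x * ε i * (if i = j then 1 else 0)) (i j k : Fin n) :
    pd k (pd j (z i)) = fun x => 1 / 2 * ((if i = j then pd k ρ x else 0)
      + (if i = k then pd j ρ x else 0) - (if j = k then ε i * ε j * pd i ρ x else 0)) := by
  have h1 : ∀ i j k x, ε i * pd k (pd j (z i)) x + ε j * pd k (pd i (z j)) x
      = (ε i * (if i = j then 1 else 0)) * pd k ρ x := by
    intro i j k x
    have e : (fun y => ε i * pd j (z i) y + ε j * pd i (z j) y)
        = fun y => (ε i * (if i = j then 1 else 0)) * ρ y := by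
      funext y; rw [hK]; ring
    have e' := congrFun (congrArg (pd k) e) x
    rwa [pd_add (contDiff_const.mul ((hz i).pd j)) (contDiff_const.mul ((hz j).pd i)),
      pd_cmulR ((hz i).pd j), pd_cmulR ((hz j).pd i), pd_cmulR hρ] at e'
  funext x
  have a := h1 i j k x
  have b := h1 i k j x
  have c := h1 j k i x
  rw [pd_comm (hz i) j k] at b
  rw [pd_comm (hz j) i k, pd_comm (hz k) i j] at c
  have hi := hε i
  have hj := hε j
  have main : 2 * (ε i * pd k (pd j (z i)) x) = (ε i * (if i = j then 1 else 0)) * pd k ρ x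
    + (ε i * (if i = k then 1 else 0)) * pd j ρ x - (ε j * (if j = k then 1 else 0)) * pd i ρ x := by
    linarith
  have main' : pd k (pd j (z i)) x = 1 / 2 * ε i * ((ε i * (if i = j then 1 else 0)) * pd k ρ x
    + (ε i * (if i = k then 1 else 0)) * pd j ρ x - (ε j * (if j = k then 1 else 0)) * pd i ρ x) := by
    rw [← main]; linear_combination (- pd k (pd j (z i)) x) * hi
  rw [main']
  split_ifs <;> simp only [mul_one, mul_zero, zero_mul, sub_zero, add_zero, zero_add] <;>
    first
    | linear_combination (1 / 2 * (pd k ρ x + pd j ρ x)) * hi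
    | linear_combination (1 / 2 * (pd k ρ x)) * hi
    | linear_combination (1 / 2 * (pd j ρ x)) * hi
    | ring

lemma kill_hess (hn : 3 ≤ n) (ε : Fin n → ℝ) (hε : ∀ j, ε j * ε j = 1)
    (z : Fin n → (Fin n → ℝ) → ℝ)
    (ρ : (Fin n → ℝ) → ℝ) (hz : ∀ i, Sm (z i)) (hρ : Sm ρ)
    (hK : ∀ i j x, ε i * pd j (z i) x + ε j * pd i (z j) x
        = ρ x * ε i * (if i = j then 1 else 0)) (l k : Fin n) :
    pd l (pd k ρ) = fun _ => 0 := by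
  have h3 : ∀ i j k l x, pd l (pd k (pd j (z i))) x = 
      1 / 2 * ((if i = j then pd l (pd k ρ) x else 0)
      + (if i = k then pd l (pd j ρ) x else 0) - (if j = k then ε i * ε j * pd l (pd i ρ) x else 0)) := by
    intro i j k l x
    rw [kill2 ε hε z ρ hz hρ hK i j k]
    have : (fun x => 1 / 2 * ((if i = j then pd k ρ x else 0)
      + (if i = k then pd j ρ x else 0) - (if j = k then ε i * ε j * pd i ρ x else 0)))
      = fun x => ((1 / 2 * (if i = j then 1 else 0)) * pd k ρ x 
        + (1 / 2 * (if i = k then 1 else 0)) * pd j ρ x)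
        + (-(1 / 2) * (if j = k then ε i * ε j else 0)) * pd i ρ x := by
      funext x; split_ifs <;> ring
    rw [this, pd_add ((contDiff_const.mul (hρ.pd k)).add (contDiff_const.mul (hρ.pd j)))
      (contDiff_const.mul (hρ.pd i)), 
      pd_add (contDiff_const.mul (hρ.pd k)) (contDiff_const.mul (hρ.pd j)),
      pd_cmulR (hρ.pd k), pd_cmulR (hρ.pd j), pd_cmulR (hρ.pd i)]
    beta_reduce
    split_ifs <;> ring
  have h4 : ∀ i j l, j ≠ i → l ≠ i → ∀ x, pd l (pd j ρ) x
      = - (if j = l then ε i * ε j * pd i (pd i ρ) x else 0) := by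
    intro i j l hj hl x
    have a := h3 i j i l x
    have b := h3 i j l i x
    rw [pd_comm ((hz i).pd j) l i] at a
    rw [a] at b
    rw [if_neg (Ne.symm hj), if_neg (Ne.symm hj), if_pos rfl, if_neg hj, if_neg (Ne.symm hl)] at b
    linarith
  have h5 : ∀ a b : Fin n, ∃ c, c ≠ a ∧ c ≠ b := by
    intro a b
    have : ({a, b} : Finset (Fin n)).card < Fintype.card (Fin n) := by
      have := Finset.card_le_two (a := a) (b := b)
      simp; omega
    obtain ⟨c, hc⟩ := Finset.exists_mem_notMem_of_card_lt_card (s := {a, b}) (t := Finset.univ) (by simpa using this)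
    exact ⟨c, by simpa using hc.2⟩
  funext x
  by_cases hlk : k = l
  · subst hlk
    obtain ⟨i, hi, -⟩ := h5 k k
    obtain ⟨j, hj, hji⟩ := h5 k i
    have a := h4 i k k (Ne.symm hi) (Ne.symm hi) x
    have b := h4 j k k (Ne.symm hj) (Ne.symm hj) x
    have c := h4 j i i (Ne.symm hji) (Ne.symm hji) x
    rw [if_pos rfl] at a b c
    have ei := hε i
    rw [c] at a
    have : ε i * ε k * (ε j * ε i * pd j (pd j ρ) x) = ε j * ε k * pd j (pd j ρ) x := by
      linear_combination (ε j * ε k * pd j (pd j ρ) x) * ei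
    linarith
  · obtain ⟨i, hi, hi'⟩ := h5 k l
    rw [h4 i k l (Ne.symm hi) (Ne.symm hi') x, if_neg hlk, neg_zero]

/-- tangential derivative of a function vanishing on the hyperplane -/
lemma pd_tangent (i₀ i : Fin n) (hi : i ≠ i₀) (f : (Fin n → ℝ) → ℝ) (hf : Sm f)
    (h0 : ∀ x : Fin n → ℝ, x i₀ = 0 → f x = 0) (x : Fin n → ℝ) (hx : x i₀ = 0) : pd i f x = 0 := by
  have h := (hf.diff x).hasFDerivAt.hasLineDerivAt (Pi.single i 1)
  have h2 : HasLineDerivAt ℝ f 0 x (Pi.single i 1) := by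
    unfold HasLineDerivAt
    have : (fun t : ℝ => f (x + t • Pi.single i 1)) = fun _ => 0 := by
      funext t
      apply h0
      simp [hx, Ne.symm hi]
    rw [this]
    exact hasDerivAt_const _ _
  exact h.unique h2
end killing

theorem stmt0 (n : ℕ) (hn : 3 ≤ n) (ε : Fin n → ℝ) (hε : ∀ j, ε j = 1 ∨ ε j = -1)
    (u : ℂ) (ℓ : ℕ) :
    IsCovariantSymbol ε ⟨n - 1, by omega⟩ u (u + ℓ)
      (juhlSymbol ε ⟨n - 1, by omega⟩ (u - ((n : ℂ) - 1) / 2) ℓ) := by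
  intro Z ρ hZ htan f hf x hx
  obtain ⟨hZs, hρ, hK⟩ := hZ
  rw [contDiffOn_univ] at hZs hρ
  have hρ : Sm ρ := hρ
  have hf : Sm f := hf
  generalize (⟨n - 1, by omega⟩ : Fin n) = i₀ at *
  have hee : ∀ j, ε j * ε j = 1 := fun j => by rcases hε j with h | h <;> rw [h] <;> norm_num
  have heC : ∀ j, (ε j : ℂ) * ε j = 1 := fun j => by exact_mod_cast hee j
  have hz : ∀ i, Sm (fun y => Z y i) := fun i => (contDiff_pi.1 hZs) i
  have hK' : ∀ i j x, ε i * pd j (fun y => Z y i) x + ε j * pd i (fun y => Z y j) x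
        = ρ x * ε i * (if i = j then 1 else 0) := fun i j x => hK i j x (Set.mem_univ _)
  have k2 := kill2 ε hee (fun i y => Z y i) ρ hz hρ hK'
  have kh := kill_hess hn ε hee (fun i y => Z y i) ρ hz hρ hK'
  -- tangency
  have t1 : ∀ i, i ≠ i₀ → ∀ x : Fin n → ℝ, x i₀ = 0 → pd i (fun y => Z y i₀) x = 0 :=
    fun i hi x hx => pd_tangent i₀ i hi _ (hz i₀) htan x hx
  have t2 : ∀ i, i ≠ i₀ → ∀ x : Fin n → ℝ, x i₀ = 0 → pd i₀ (fun y => Z y i) x = 0 := by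
    intro i hi x hx
    have a := hK' i i₀ x
    rw [t1 i hi x hx, if_neg hi] at a
    have b := hee i
    linear_combination ε i * a - pd i₀ (fun y => Z y i) x * b
  have hb0 : pd i₀ ρ x = 0 := by
    obtain ⟨i, hi⟩ : ∃ i : Fin n, i ≠ i₀ := by
      haveI : Nontrivial (Fin n) := Fin.nontrivial_iff_two_le.2 (by omega)
      exact exists_ne i₀
    have a := pd_tangent i₀ i hi _ ((hz i).pd i₀) (t2 i hi) x hx
    have b := congrFun (k2 i i₀ i) x
    rw [a, if_neg hi, if_pos rfl, if_neg (Ne.symm hi)] at b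
    linarith
  -- third derivatives vanish
  have hz3 : ∀ m i j k, pd i (pd j (pd k (fun y => Z y m))) = fun _ => 0 := by
    intro m i j k
    rw [k2 m k j]
    have : (fun x => 1 / 2 * ((if m = k then pd j ρ x else 0)
      + (if m = j then pd k ρ x else 0) - (if k = j then ε m * ε k * pd m ρ x else 0)))
      = fun x => ((1 / 2 * (if m = k then 1 else 0)) * pd j ρ x 
        + (1 / 2 * (if m = j then 1 else 0)) * pd k ρ x)
        + (-(1 / 2) * (if k = j then ε m * ε k else 0)) * pd m ρ x := by
      funext x; split_ifs <;> ring
    rw [this, pd_add ((contDiff_const.mul (hρ.pd j)).add (contDiff_const.mul (hρ.pd k)))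
      (contDiff_const.mul (hρ.pd m)), 
      pd_add (contDiff_const.mul (hρ.pd j)) (contDiff_const.mul (hρ.pd k)),
      pd_cmulR (hρ.pd j), pd_cmulR (hρ.pd k), pd_cmulR (hρ.pd m), kh, kh, kh]
    funext x; simp
  have cz1 : ∀ m i, pd i (fun y => (Z y m : ℂ)) = fun y => ((pd i (fun y => Z y m) y : ℝ) : ℂ) :=
    fun m i => pd_ofReal (hz m) i
  have cz2 : ∀ m i k, pd i (pd k (fun y => (Z y m : ℂ)))
      = fun y => ((pd i (pd k (fun y => Z y m)) y : ℝ) : ℂ) :=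
    fun m i k => by rw [cz1, pd_ofReal ((hz m).pd k)]
  have cz3 : ∀ m i j k, pd i (pd j (pd k (fun y => (Z y m : ℂ)))) = fun _ => 0 := by
    intro m i j k
    rw [cz2, pd_ofReal (((hz m).pd k).pd j), hz3]; simp
  have cr1 : ∀ i, pd i (fun y => (ρ y : ℂ)) = fun y => ((pd i ρ y : ℝ) : ℂ) :=
    fun i => pd_ofReal hρ i
  have cr2 : ∀ i k, pd i (pd k (fun y => (ρ y : ℂ))) = fun _ => 0 := by
    intro i k
    rw [cr1, pd_ofReal (hρ.pd k), kh]; simp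
  have cr3 : ∀ i j k, pd i (pd j (pd k (fun y => (ρ y : ℂ)))) = fun _ => 0 := by
    intro i j k
    rw [cr2, pd_const]
  obtain ⟨P, hP⟩ : ∃ P, P = juhlSymbol ε i₀ (u - ((n : ℂ) - 1) / 2) ℓ := ⟨_, rfl⟩
  rw [← hP]
  have pI := congrArg (Lx f x) (partI ε heC i₀ _ ℓ P hP
    (fun i j => ((pd j (fun y => Z y i) x : ℝ) : ℂ)) (ρ x) (fun i j => by
      have := hK' i j x
      have h2 := congrArg (fun t : ℝ => (t : ℂ)) this
      push_cast at h2
      rw [h2]; split_ifs <;> simp) (fun i hi => by rw [t1 i hi x hx]; simp))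
  have pII := congrArg (Lx f x) (partII ε heC i₀ u ℓ P hP
    (fun j i k => ((pd i (pd k (fun y => Z y j)) x : ℝ) : ℂ)) (fun i => ((pd i ρ x : ℝ) : ℂ))
    (by simp [hb0]) (fun j i k => by
      rw [k2 j k i]
      push_cast
      split_ifs <;> simp))
  have hfj : ∀ j, Sm (fun y => (Z y j : ℂ) * pd j f y) := fun j =>
    ContDiff.mul (hz j).ofReal (hf.pd j)
  have hrf : Sm (fun y => (ρ y : ℂ) * f y) := ContDiff.mul hρ.ofReal hf
  simp only [pd_polyDiff hf]
  rw [Lx_eq, Lx_eq]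
  have hassoc : (fun y => (∑ j, (Z y j : ℂ) * pd j f y) + u / 2 * (ρ y : ℂ) * f y)
    = fun y => (∑ j, (Z y j : ℂ) * pd j f y) + u / 2 * ((ρ y : ℂ) * f y) := by
    funext y; ring
  rw [hassoc, Lx_add (ContDiff.sum fun j _ => hfj j) (contDiff_const.mul hrf),
    Lx_sum _ (fun j _ => hfj j), Lx_cmul hrf, leibniz P hρ.ofReal hf cr3]
  simp only [fun j => leibniz P (hz j).ofReal (hf.pd j) (cz3 j) x]
  simp only [cz2, cr2]
  simp only [cz1, cr1]
  simp only [map_add, map_sum, Lx_C_mul, map_zero, Lx_mul_X hf] at pI pII ⊢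
  rw [Finset.sum_add_distrib, Finset.sum_add_distrib, pI, ← Finset.mul_sum,
    ← Finset.add_sum_erase _ _ (Finset.mem_univ i₀), htan x hx]
  simp only [Complex.ofReal_zero, zero_mul, Finset.sum_const_zero, mul_zero, add_zero, zero_add]
  linear_combination pII
end
end

section
/- Let n ≥ 3, ε ∈ {−1,1}^n and u, v ∈ ℂ. Then any two (ε,u,v)-covariant symbols P, Q ∈ ℂ[X_1,…,X_n] are linearly dependent over ℂ; i.e., the complex vector space of (ε,u,v)-covariant symbols has dimension at most 1. (Scalar case i = j = 0 of the multiplicity bound in Theorem C(1).) -/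
open scoped BigOperators

noncomputable section

open MvPolynomial

section helpers

variable {n : ℕ}

def ev {A : Type} [NormedCommRing A] [NormedAlgebra ℝ A] (F : MvPolynomial (Fin n) A) :
    (Fin n → ℝ) → A :=
  fun y => MvPolynomial.eval (fun j => algebraMap ℝ A (y j)) F

lemma ev_contDiff {A : Type} [NormedCommRing A] [NormedAlgebra ℝ A]
    (F : MvPolynomial (Fin n) A) : ContDiff ℝ (⊤ : ℕ∞) (ev F) := by
  induction F using MvPolynomial.induction_on with
  | C a =>
    have h : ev (C a : MvPolynomial (Fin n) A) = fun _ => a := by ext; simp [ev]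
    rw [h]; exact (contDiff_const : ContDiff ℝ (⊤ : ℕ∞) (fun _ : Fin n → ℝ => a))
  | add p q hp hq =>
    have h : ev (p + q) = fun y => ev p y + ev q y := by ext; simp [ev]
    rw [h]; exact hp.add hq
  | mul_X p i hp =>
    have h : ContDiff ℝ (⊤ : ℕ∞) (fun y : Fin n → ℝ => algebraMap ℝ A (y i)) :=
      (algebraMapCLM ℝ A).contDiff.comp (contDiff_apply ℝ ℝ i)
    have h3 : ev (p * X i) = fun y : Fin n → ℝ => ev p y * algebraMap ℝ A (y i) := by
      ext; simp [ev]
    rw [h3]; exact hp.mul h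

lemma pd_ev {A : Type} [NormedCommRing A] [NormedAlgebra ℝ A]
    (j : Fin n) (F : MvPolynomial (Fin n) A) : pd j (ev F) = ev (pderiv j F) := by
  have hd : ∀ G : MvPolynomial (Fin n) A, Differentiable ℝ (ev G) := fun G =>
    (ev_contDiff G).differentiable (by simp)
  induction F using MvPolynomial.induction_on with
  | C a =>
    have : ev (C a : MvPolynomial (Fin n) A) = fun _ => a := by ext; simp [ev]
    rw [this]; ext x; simp [pd, ev]
  | add p q hp hq =>
    have : ev (p + q) = ev p + ev q := by ext; simp [ev]
    ext x
    have h1 := congrFun hp x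
    have h2 := congrFun hq x
    simp only [pd] at h1 h2 ⊢
    rw [this, fderiv_add (hd p x) (hd q x)]
    simp [h1, h2]
    simp [ev]
  | mul_X p i hp =>
    ext x
    have h1 : HasFDerivAt (fun y : Fin n → ℝ => algebraMap ℝ A (y i))
        ((algebraMapCLM ℝ A).comp (ContinuousLinearMap.proj (R := ℝ) (φ := fun _ : Fin n => ℝ) i)) x := by
      exact ((algebraMapCLM ℝ A).comp (ContinuousLinearMap.proj (R := ℝ) (φ := fun _ : Fin n => ℝ) i)).hasFDerivAt
    have h2 := (hd p x).hasFDerivAt.mul h1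
    have h3 : ev (p * X i) = (ev p * fun y : Fin n → ℝ => algebraMap ℝ A (y i)) := by
      ext; simp [ev]
    have h4 := congrFun hp x
    simp only [pd] at h4 ⊢
    rw [h3, h2.fderiv]
    simp [h4]
    by_cases hij : i = j
    · subst hij; simp [ev]
    · simp [ev, hij]

lemma pd_iter_ev (j : Fin n) (k : ℕ) (F : MvPolynomial (Fin n) ℂ) :
    (pd j)^[k] (ev F) = ev ((pderiv j)^[k] F) := by
  induction k generalizing F with
  | zero => rfl
  | succ k ih => rw [Function.iterate_succ_apply, pd_ev, ih, Function.iterate_succ_apply]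

def pfold (m : Fin n → ℕ) (l : List (Fin n)) (F : MvPolynomial (Fin n) ℂ) :
    MvPolynomial (Fin n) ℂ :=
  l.foldr (fun j g => (pderiv j)^[m j] g) F

lemma foldr_ev (m : Fin n → ℕ) (l : List (Fin n)) (F : MvPolynomial (Fin n) ℂ) :
    l.foldr (fun j g => (pd j)^[m j] g) (ev F) = ev (pfold m l F) := by
  induction l with
  | nil => rfl
  | cons a l ih => simp only [List.foldr_cons, ih, pd_iter_ev, pfold]

lemma coeff_iter (j : Fin n) (k : ℕ) (s : Fin n →₀ ℕ) :
    ∃ N : ℂ, N ≠ 0 ∧ ∀ F : MvPolynomial (Fin n) ℂ,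
      coeff s ((pderiv j)^[k] F) = N * coeff (s + Finsupp.single j k) F := by
  induction k generalizing s with
  | zero => exact ⟨1, one_ne_zero, fun F => by simp⟩
  | succ k ih =>
    obtain ⟨N, hN, h⟩ := ih (s + Finsupp.single j 1)
    refine ⟨N * (s j + 1 : ℕ), mul_ne_zero hN (Nat.cast_ne_zero.2 (Nat.succ_ne_zero (s j))), fun F => ?_⟩
    rw [Function.iterate_succ_apply', coeff_pderiv, h]
    rw [add_assoc, ← Finsupp.single_add, add_comm 1 k]
    push_cast
    ring

lemma coeff_pfold (m : Fin n → ℕ) (l : List (Fin n)) (s : Fin n →₀ ℕ) :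
    ∃ N : ℂ, N ≠ 0 ∧ ∀ F : MvPolynomial (Fin n) ℂ,
      coeff s (pfold m l F) = N * coeff (s + (l.map fun j => Finsupp.single j (m j)).sum) F := by
  induction l generalizing s with
  | nil => exact ⟨1, one_ne_zero, fun F => by simp [pfold]⟩
  | cons a l ih =>
    obtain ⟨N, hN, h⟩ := coeff_iter a (m a) s
    obtain ⟨N', hN', h'⟩ := ih (s + Finsupp.single a (m a))
    refine ⟨N * N', mul_ne_zero hN hN', fun F => ?_⟩
    have : pfold m (a :: l) F = (pderiv a)^[m a] (pfold m l F) := rfl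
    rw [this, h, h', List.map_cons, List.sum_cons, add_assoc, mul_assoc]

lemma monoDiff_ev (m : Fin n →₀ ℕ) :
    ∃ N : ℂ, N ≠ 0 ∧ ∀ F : MvPolynomial (Fin n) ℂ,
      monoDiff (fun j => m j) (ev F) 0 = N * coeff m F := by
  obtain ⟨N, hN, h⟩ := coeff_pfold (fun j => m j) (List.finRange n) 0
  refine ⟨N, hN, fun F => ?_⟩
  have hs : ((List.finRange n).map fun j => Finsupp.single j (m j)).sum = m := by
    rw [← List.ofFn_eq_map, List.sum_ofFn]
    exact Finsupp.univ_sum_single m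
  rw [monoDiff, foldr_ev]
  have : ∀ G : MvPolynomial (Fin n) ℂ, ev G 0 = coeff 0 G := by
    intro G
    have : (fun j : Fin n => algebraMap ℝ ℂ ((0 : Fin n → ℝ) j)) = 0 := by ext; simp
    rw [ev, this, ← constantCoeff_eq, constantCoeff, eval]
    simp [constantCoeff, eval]
    try rfl
  rw [this, h, hs, zero_add]

def NN (m : Fin n →₀ ℕ) : ℂ := (monoDiff_ev m).choose
lemma NN_ne (m : Fin n →₀ ℕ) : NN m ≠ 0 := (monoDiff_ev m).choose_spec.1
lemma NN_spec (m : Fin n →₀ ℕ) (F : MvPolynomial (Fin n) ℂ) :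
    monoDiff (fun j => m j) (ev F) 0 = NN m * coeff m F := (monoDiff_ev m).choose_spec.2 F

def Lam (P : MvPolynomial (Fin n) ℂ) : MvPolynomial (Fin n) ℂ →ₗ[ℂ] ℂ :=
  ∑ m ∈ P.support, (P.coeff m * NN m) • MvPolynomial.lcoeff ℂ m

lemma polyDiff_ev (P F : MvPolynomial (Fin n) ℂ) : polyDiff P (ev F) 0 = Lam P F := by
  simp [polyDiff, Lam, NN_spec, mul_assoc]

lemma Lam_monomial (P : MvPolynomial (Fin n) ℂ) (m : Fin n →₀ ℕ) :
    Lam P (monomial m 1) = P.coeff m * NN m := by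
  classical
  simp only [Lam, LinearMap.sum_apply, LinearMap.smul_apply, lcoeff_apply, coeff_monomial,
    smul_eq_mul, mul_ite, mul_one, mul_zero]
  rw [Finset.sum_ite_eq]
  split_ifs with h
  · rfl
  · rw [notMem_support_iff.mp h, zero_mul]

lemma key {ε : Fin n → ℝ} {i₀ : Fin n} {u v : ℂ} {P : MvPolynomial (Fin n) ℂ}
    (hP : IsCovariantSymbol ε i₀ u v P)
    (Z : Fin n → MvPolynomial (Fin n) ℝ) (ρ : MvPolynomial (Fin n) ℝ)
    (hK : ∀ i j, C (ε i) * pderiv j (Z i) + C (ε j) * pderiv i (Z j)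
      = if i = j then ρ * C (ε i) else 0)
    (hT : ∀ x : Fin n → ℝ, x i₀ = 0 → eval x (Z i₀) = 0)
    (h0 : ∀ j, eval 0 (Z j) = 0) (F : MvPolynomial (Fin n) ℂ) :
    Lam P ((∑ j, map (algebraMap ℝ ℂ) (Z j) * pderiv j F)
      + C (u / 2) * (map (algebraMap ℝ ℂ) ρ) * F) = v / 2 * ((eval 0 ρ : ℝ) : ℂ) * Lam P F := by
  have evR : ∀ G : MvPolynomial (Fin n) ℝ, ev G = fun y => eval y G := by
    intro G; ext y; simp [ev]
  have evC : ∀ (G : MvPolynomial (Fin n) ℝ) (y : Fin n → ℝ),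
      ((eval y G : ℝ) : ℂ) = ev (map (algebraMap ℝ ℂ) G) y := by
    intro G y
    induction G using MvPolynomial.induction_on with
    | C a => simp [ev]
    | add p q hp hq => simp only [ev, map_add, Complex.ofReal_add] at hp hq ⊢; rw [hp, hq]
    | mul_X p i hp =>
      simp only [ev, map_mul, Complex.ofReal_mul] at hp ⊢; rw [hp]; simp
  have h := hP (fun y i => eval y (Z i)) (fun y => eval y ρ) ⟨?_, ?_, ?_⟩ hT (ev F)
    (ev_contDiff F) 0 rfl
  · rw [← polyDiff_ev, ← polyDiff_ev]
    simp only [h0] at h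
    simp only [Complex.ofReal_zero, zero_mul, Finset.sum_const_zero, zero_add] at h
    rw [← h]
    congr 1
    ext y
    simp only [evC, pd_ev]
    simp [ev, map_sum]
  · exact (contDiff_pi.2 fun i => by rw [← evR]; exact ev_contDiff _).contDiffOn
  · rw [← evR]; exact (ev_contDiff _).contDiffOn
  · intro i j x _
    simp only [← evR, pd_ev]
    have := congrArg (eval x) (hK i j)
    simp only [evR]
    split_ifs at this ⊢ <;> simpa using this

abbrev mon (m : Fin n →₀ ℕ) : MvPolynomial (Fin n) ℂ := monomial m 1

abbrev e (j : Fin n) : Fin n →₀ ℕ := Finsupp.single j 1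

lemma pderiv_mon (m : Fin n →₀ ℕ) (j : Fin n) :
    pderiv j (mon (m + e j)) = C (m j + 1 : ℂ) * mon m := by
  rw [mon, mon, pderiv_monomial, C_mul_monomial]; simp [e]

lemma pderiv_mon_zero (m : Fin n →₀ ℕ) (j : Fin n) (h : m j = 0) :
    pderiv j (mon m) = 0 := by
  simp [mon, pderiv_monomial, h]

lemma X_mul_mon (m : Fin n →₀ ℕ) (j : Fin n) : X j * mon m = mon (m + e j) := by
  rw [X, mon, monomial_mul, add_comm, one_mul]

lemma euler_mon (m : Fin n →₀ ℕ) : ∑ j, X j * pderiv j (mon m) = C ((∑ j, m j : ℕ) : ℂ) * mon m := by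
  have : ∀ j, X j * pderiv j (mon m) = C (m j : ℂ) * mon m := by
    intro j
    by_cases h : m j = 0
    · rw [pderiv_mon_zero m j h, h]; simp
    · obtain ⟨m', rfl⟩ : ∃ m', m = m' + e j := by
        refine ⟨m - e j, (tsub_add_cancel_of_le ?_).symm⟩
        simpa [e, Nat.one_le_iff_ne_zero] using h
      rw [pderiv_mon, mul_left_comm, X_mul_mon]
      simp [e]
  simp only [this, ← Finset.sum_mul]
  simp

lemma Lam_C_mul (P F : MvPolynomial (Fin n) ℂ) (a : ℂ) : Lam P (C a * F) = a * Lam P F := by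
  rw [C_mul', map_smul, smul_eq_mul]

lemma pderiv_C_mul' (a : ℝ) (j : Fin n) (F : MvPolynomial (Fin n) ℝ) :
    pderiv j (C a * F) = C a * pderiv j F := by simp

lemma dX (i j : Fin n) : pderiv j (X i : MvPolynomial (Fin n) ℝ) = if i = j then 1 else 0 := by
  split_ifs with h
  · subst h; simp
  · exact pderiv_X_of_ne h

lemma dq (ε : Fin n → ℝ) (b : Fin n) :
    pderiv b (∑ l, C (ε l) * (X l * X l) : MvPolynomial (Fin n) ℝ) = 2 * C (ε b) * X b := by
  simp only [map_sum, pderiv_C, pderiv_mul, zero_add, Finset.sum_const_zero, dX, ite_mul, mul_ite, one_mul, mul_one,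
    zero_mul, mul_zero, mul_add, Finset.sum_add_distrib, Finset.sum_ite_eq', Finset.mem_univ,
    if_true]
  ring

/-- The coefficient relations. -/
structure CRel (ε : Fin n → ℝ) (i₀ : Fin n) (u v : ℂ) (d : (Fin n →₀ ℕ) → ℂ) : Prop where
  H : ∀ m, (((∑ j, m j : ℕ) : ℂ) + u - v) * d m = 0
  R1 : ∀ i j, i ≠ i₀ → j ≠ i₀ → i ≠ j → ∀ m : Fin n →₀ ℕ, m j = 0 → d (m + e j) = 0
  R2 : ∀ i j, i ≠ i₀ → j ≠ i₀ → i ≠ j → ∀ m : Fin n →₀ ℕ,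
    (ε i : ℂ) * (m i + 1) * d (m + e j + e j) = (ε j : ℂ) * (m j + 1) * d (m + e i + e i)
  S : ∀ j, j ≠ i₀ → ∀ m : Fin n →₀ ℕ,
    (2 * (ε j : ℂ) * (((∑ k, m k : ℕ) : ℂ) + 1) + 2 * u * ε j) * d (m + e j + e j)
      = (m j + 1) * ∑ l, (ε l : ℂ) * d (m + e l + e l)

lemma rel_of_cov {ε : Fin n → ℝ} (hε : ∀ j, ε j = 1 ∨ ε j = -1) {i₀ : Fin n} {u v : ℂ}
    {P : MvPolynomial (Fin n) ℂ}
    (hP : IsCovariantSymbol ε i₀ u v P) : CRel ε i₀ u v (fun m => Lam P (mon m)) := by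
  have hsq : ∀ j, C (ε j) * C (ε j) = (1 : MvPolynomial (Fin n) ℝ) := by
    intro j; rw [← C_mul]; rcases hε j with h | h <;> simp [h]
  have hne : ∀ j, (ε j : ℂ) ≠ 0 := by
    intro j; rcases hε j with h | h <;> simp [h]
  have rot : ∀ i j, i ≠ i₀ → j ≠ i₀ → i ≠ j → ∀ F : MvPolynomial (Fin n) ℂ,
      Lam P (C (ε i : ℂ) * (X j * pderiv i F) - C (ε j : ℂ) * (X i * pderiv j F)) = 0 := by
    intro i j hi hj hij F
    have := key hP (fun k => (if k = i then C (ε i) * X j else 0)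
      - (if k = j then C (ε j) * X i else 0)) 0 ?_ ?_ ?_ F
    · simp only [map_sub, map_zero, sub_mul, apply_ite (map (algebraMap ℝ ℂ)), ite_mul, zero_mul,
        Finset.sum_sub_distrib, Finset.sum_ite_eq', Finset.mem_univ, if_true, map_mul, map_C, map_X,
        mul_zero, add_zero, Complex.ofReal_zero] at this
      rw [← mul_assoc, ← mul_assoc, map_sub]
      simpa using this
    · intro a b
      have h1 := hsq i
      have h2 := hsq j
      simp only [map_sub, apply_ite (pderiv _), map_zero, pderiv_C_mul', dX]
      clear hsq hne hε
      by_cases hai : a = i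
      · subst hai
        by_cases hbj : b = j
        · subst hbj
          simp [hij, Ne.symm hij]
          linear_combination h1 - h2
        · by_cases hba : b = a
          · subst hba; simp [hij, Ne.symm hij]
          · simp [hij, Ne.symm hij, hbj, hba, Ne.symm hbj, Ne.symm hba]
      · by_cases haj : a = j
        · subst haj
          by_cases hbi : b = i
          · subst hbi
            simp [hij, Ne.symm hij]
            linear_combination h1 - h2
          · by_cases hba : b = a
            · subst hba; simp [hij, Ne.symm hij]
            · simp [hij, Ne.symm hij, hbi, hba, Ne.symm hbi, Ne.symm hba]
        · by_cases hbi : b = i <;> by_cases hbj : b = j <;>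
            simp [hai, haj, hbi, hbj, Ne.symm hai, Ne.symm haj]
    · intro x hx
      simp [Ne.symm hi, Ne.symm hj]
    · intro k
      split_ifs <;> simp
  refine ⟨?_, ?_, ?_, ?_⟩
  · intro m
    have := key hP (fun k => X k) (C 2) ?_ ?_ ?_ (mon m)
    · simp only [map_X, euler_mon, map_add, map_C, eval_C, mul_assoc, Lam_C_mul] at this
      push_cast at this ⊢
      linear_combination this
    · intro i j
      by_cases h : i = j
      · subst h
        have h2 : (C 2 : MvPolynomial (Fin n) ℝ) = 2 := rfl
        simp [h2]; ring 
      · simp [h, pderiv_X_of_ne h, pderiv_X_of_ne (Ne.symm h)]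
    · intro x hx; simpa using hx
    · intro k; simp
  · intro i j hi hj hij m hm
    have := rot i j hi hj hij (mon (m + e i))
    rw [pderiv_mon, pderiv_mon_zero _ _ (by simp [e, hm, hij]), mul_left_comm (X j), X_mul_mon] at this
    simp only [mul_zero, sub_zero, Lam_C_mul] at this
    have h3 : (m i + 1 : ℂ) ≠ 0 := by exact_mod_cast Nat.succ_ne_zero (m i)
    simpa [hne, h3] using this
  · intro i j hi hj hij m
    have := rot i j hi hj hij (mon (m + e j + e i))
    rw [pderiv_mon, mul_left_comm (X j), X_mul_mon, add_right_comm m (e j) (e i), pderiv_mon,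
      mul_left_comm (X i), X_mul_mon] at this
    simp only [map_sub, Lam_C_mul] at this
    simp [e, hij, Ne.symm hij] at this
    linear_combination this
  · intro j hj m
    have := key hP (fun k => C (2 * ε j) * (X j * X k) - (if k = j then ∑ l, C (ε l) * (X l * X l) else 0))
      (C (4 * ε j) * X j) ?_ ?_ ?_ (mon (m + e j))
    · simp only [map_sub, sub_mul, apply_ite (map (algebraMap ℝ ℂ)), ite_mul, zero_mul, map_zero,
        Finset.sum_sub_distrib, Finset.sum_ite_eq', Finset.mem_univ, if_true, map_mul, map_C, map_X,
        mul_assoc, ← Finset.mul_sum, euler_mon, pderiv_mon, eval_X, map_sum] at this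
      simp only [← map_mul, mul_left_comm (X _) (C _), X_mul_mon, Finset.sum_mul, mul_assoc, Lam_C_mul,
        map_add, map_sub, map_sum] at this
      simp [Finset.sum_add_distrib] at this
      simp only [Finset.mul_sum]
      push_cast
      have hL : ∀ x, Lam P (X x * (X x * (((m j : MvPolynomial (Fin n) ℂ) + 1) * mon m)))
          = (m j + 1 : ℂ) * Lam P (mon (m + e x + e x)) := by
        intro x
        have hc : ((m j : MvPolynomial (Fin n) ℂ) + 1) = C (m j + 1 : ℂ) := by simp
        rw [hc, mul_left_comm (X x) (C _), mul_left_comm (X x) (C _), X_mul_mon, X_mul_mon,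
          Lam_C_mul]
      simp only [hL] at this
      have hs : ∑ i, ((m j : ℂ) + 1) * ((ε i : ℂ) * Lam P (mon (m + e i + e i)))
          = ∑ i, (ε i : ℂ) * (((m j : ℂ) + 1) * Lam P (mon (m + e i + e i))) :=
        Finset.sum_congr rfl fun i _ => by ring
      rw [hs]
      linear_combination this
    · intro a b
      simp only [map_sub, apply_ite (pderiv _), map_zero, pderiv_mul, pderiv_C, dX, dq, zero_mul, zero_add]
      clear hsq hne hε
      have h4 : (C (4 * ε j) : MvPolynomial (Fin n) ℝ) = 4 * C (ε j) := by rw [C_mul]; rfl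
      have h2 : (C (2 * ε j) : MvPolynomial (Fin n) ℝ) = 2 * C (ε j) := by rw [C_mul]; rfl
      rw [h4, h2]
      by_cases hab : a = b
      · subst hab
        by_cases haj : a = j
        · subst haj; simp; ring
        · simp [haj, Ne.symm haj]; ring
      · by_cases haj : a = j
        · subst haj; simp [hab, Ne.symm hab]; ring
        · by_cases hbj : b = j
          · subst hbj; simp [hab, Ne.symm hab]; ring
          · simp [hab, Ne.symm hab, haj, hbj, Ne.symm haj, Ne.symm hbj]
    · intro x hx
      simp [hx, Ne.symm hj]
    · intro k
      by_cases h : k = j <;> simp [h]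

lemma exists_sub_one (m : Fin n →₀ ℕ) (j : Fin n) (h : 1 ≤ m j) : ∃ m', m = m' + e j :=
  ⟨m - e j, (tsub_add_cancel_of_le (by simpa [e] using h)).symm⟩

lemma exists_sub_two (m : Fin n →₀ ℕ) (j : Fin n) (h : 2 ≤ m j) : ∃ m', m = m' + e j + e j := by
  obtain ⟨m', rfl⟩ := exists_sub_one m j (by omega)
  obtain ⟨m'', rfl⟩ := exists_sub_one m' j (by simp [e] at h; omega)
  exact ⟨m'', rfl⟩

lemma swap_zero {ε : Fin n → ℝ} (hε : ∀ j, ε j = 1 ∨ ε j = -1) {i₀ : Fin n} {u v : ℂ}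
    {d : (Fin n →₀ ℕ) → ℂ} (hd : CRel ε i₀ u v d) (i j : Fin n) (hi : i ≠ i₀) (hj : j ≠ i₀)
    (hij : i ≠ j) (m : Fin n →₀ ℕ) (h : d (m + e i + e i) = 0) : d (m + e j + e j) = 0 := by
  have h2 := hd.R2 i j hi hj hij m
  rw [h, mul_zero] at h2
  have h3 : (m i + 1 : ℂ) ≠ 0 := by exact_mod_cast Nat.succ_ne_zero (m i)
  have hne : (ε i : ℂ) ≠ 0 := by rcases hε i with h | h <;> simp [h]
  simpa [hne, h3] using h2

lemma odd_zero {ε : Fin n → ℝ} (hε : ∀ j, ε j = 1 ∨ ε j = -1) {i₀ : Fin n} {u v : ℂ}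
    {d : (Fin n →₀ ℕ) → ℂ} (hd : CRel ε i₀ u v d) (i j : Fin n) (hi : i ≠ i₀) (hj : j ≠ i₀)
    (hij : i ≠ j) (k : ℕ) (m : Fin n →₀ ℕ) (h : m j = 2 * k + 1) : d m = 0 := by
  induction k generalizing m with
  | zero =>
    obtain ⟨m', rfl⟩ := exists_sub_one m j (by omega)
    exact hd.R1 i j hi hj hij m' (by simpa [e] using h)
  | succ k ih =>
    obtain ⟨m', rfl⟩ := exists_sub_two m j (by omega)
    refine swap_zero hε hd i j hi hj hij m' (ih _ ?_)
    simp [e, hij] at h ⊢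
    omega

lemma sum_add_e (m : Fin n →₀ ℕ) (j : Fin n) : ∑ k, (m + e j) k = (∑ k, m k) + 1 := by
  simp [e, Finset.sum_add_distrib, Finsupp.single_apply]

lemma rel_zero {ε : Fin n → ℝ} (hε : ∀ j, ε j = 1 ∨ ε j = -1) {i₀ : Fin n} {u v : ℂ}
    (i₁ i₂ : Fin n) (h1 : i₁ ≠ i₀) (h2 : i₂ ≠ i₀) (h12 : i₁ ≠ i₂) :
    ∃ m₀ : Fin n →₀ ℕ, ∀ d, CRel ε i₀ u v d → d m₀ = 0 → ∀ m, d m = 0 := by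
  by_cases hl : ∃ l : ℕ, v = l + u
  swap
  · refine ⟨0, fun d hd _ m => ?_⟩
    have := hd.H m
    rcases mul_eq_zero.1 this with h | h
    · exact absurd ⟨∑ j, m j, by linear_combination -h⟩ hl
    · exact h
  obtain ⟨l, rfl⟩ := hl
  refine ⟨Finsupp.single i₁ (2 * (l / 2)) + Finsupp.single i₀ (l % 2), fun d hd h0 => ?_⟩
  have hH : ∀ m : Fin n →₀ ℕ, ∑ j, m j ≠ l → d m = 0 := by
    intro m hm
    rcases mul_eq_zero.1 (hd.H m) with h | h
    · refine absurd ?_ hm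
      have : ((∑ j, m j : ℕ) : ℂ) = l := by linear_combination h
      exact_mod_cast this
    · exact h
  have hodd : ∀ j, j ≠ i₀ → ∀ m : Fin n →₀ ℕ, m j % 2 = 1 → d m = 0 := by
    intro j hj m hm
    by_cases h : j = i₁
    · subst h; exact odd_zero hε hd i₂ j h2 hj h12.symm (m j / 2) m (by omega)
    · exact odd_zero hε hd i₁ j h1 hj (Ne.symm h) (m j / 2) m (by omega)
  have base : ∀ t : ℕ, ∀ m : Fin n →₀ ℕ, (∑ k, m k) - m i₁ ≤ t → m i₀ ≤ 1 → d m = 0 := by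
    intro t
    induction t using Nat.strong_induction_on with
    | _ t ih =>
    intro m ht hm
    by_cases hk : ∃ k, k ≠ i₀ ∧ k ≠ i₁ ∧ m k ≠ 0
    · obtain ⟨k, hk0, hk1, hmk⟩ := hk
      rcases Nat.mod_two_eq_zero_or_one (m k) with hp | hp
      · obtain ⟨m', rfl⟩ := exists_sub_two m k (by omega)
        refine swap_zero hε hd i₁ k h1 hk0 (Ne.symm hk1) m' ?_
        have hle : m' i₁ ≤ ∑ k, m' k := Finset.single_le_sum (f := fun k => m' k)
          (fun _ _ => Nat.zero_le _) (Finset.mem_univ i₁)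
        rw [sum_add_e, sum_add_e] at ht
        have ha : (m' + e k + e k) i₁ = m' i₁ := by simp [e, hk1]
        rw [ha] at ht
        refine ih (t - 2) (by omega) _ ?_ ?_
        · rw [sum_add_e, sum_add_e]
          simp [e]; omega
        · simpa [e, hk0, h1] using hm
      · exact hodd k hk0 m hp
    · push Not at hk
      by_cases hsum : ∑ j, m j = l
      swap
      · exact hH m hsum
      have hm' : m = Finsupp.single i₁ (m i₁) + Finsupp.single i₀ (m i₀) := by
        ext k
        by_cases hk0 : k = i₀
        · subst hk0; simp [h1]
        · by_cases hk1 : k = i₁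
          · subst hk1; simp [Ne.symm h1]
          · simp [hk k hk0 hk1, Finsupp.single_apply, Ne.symm hk0, Ne.symm hk1]
      have hs2 : m i₁ + m i₀ = l := by
        rw [← hsum]
        conv_rhs => rw [hm']
        simp [Finset.sum_add_distrib, Finsupp.single_apply]
      rcases Nat.mod_two_eq_zero_or_one (m i₁) with hp | hp
      · rw [hm', show m i₁ = 2 * (l / 2) by omega, show m i₀ = l % 2 by omega]
        exact h0
      · exact hodd i₁ h1 m hp
  have main : ∀ s : ℕ, ∀ m : Fin n →₀ ℕ, m i₀ ≤ s → d m = 0 := by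
    intro s
    induction s with
    | zero => exact fun m hm => base _ m le_rfl (by omega)
    | succ s ih =>
      intro m hm
      by_cases hs : m i₀ ≤ 1
      · exact base _ m le_rfl hs
      obtain ⟨m', rfl⟩ := exists_sub_two m i₀ (by omega)
      have hz : ∀ k, k ≠ i₀ → d (m' + e k + e k) = 0 := by
        intro k hk
        apply ih
        simp [e, hk] at hm ⊢
        omega
      have hS := hd.S i₁ h1 m'
      rw [hz i₁ h1, mul_zero, Finset.sum_eq_single i₀ (fun b _ hb => by rw [hz b hb, mul_zero])
        (by simp)] at hS
      have h3 : (m' i₁ + 1 : ℂ) ≠ 0 := by exact_mod_cast Nat.succ_ne_zero (m' i₁)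
      have hne : (ε i₀ : ℂ) ≠ 0 := by rcases hε i₀ with h | h <;> simp [h]
      simpa [hne, h3] using hS.symm
  exact fun m => main _ m le_rfl

lemma CRel.comb {ε : Fin n → ℝ} {i₀ : Fin n} {u v : ℂ} {d d' : (Fin n →₀ ℕ) → ℂ}
    (hd : CRel ε i₀ u v d) (hd' : CRel ε i₀ u v d') (a b : ℂ) :
    CRel ε i₀ u v (fun m => a * d m + b * d' m) := by
  refine ⟨fun m => ?_, fun i j hi hj hij m hm => ?_, fun i j hi hj hij m => ?_, fun j hj m => ?_⟩
  · linear_combination a * hd.H m + b * hd'.H m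
  · simp [hd.R1 i j hi hj hij m hm, hd'.R1 i j hi hj hij m hm]
  · linear_combination a * hd.R2 i j hi hj hij m + b * hd'.R2 i j hi hj hij m
  · have h : ∑ l, (ε l : ℂ) * (a * d (m + e l + e l) + b * d' (m + e l + e l))
        = a * ∑ l, (ε l : ℂ) * d (m + e l + e l) + b * ∑ l, (ε l : ℂ) * d' (m + e l + e l) := by
      rw [Finset.mul_sum, Finset.mul_sum, ← Finset.sum_add_distrib]
      exact Finset.sum_congr rfl fun l _ => by ring
    rw [h]
    linear_combination a * hd.S j hj m + b * hd'.S j hj m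

end helpers

theorem stmt2 (n : ℕ) (hn : 3 ≤ n) (ε : Fin n → ℝ) (hε : ∀ j, ε j = 1 ∨ ε j = -1)
    (u v : ℂ) (P Q : MvPolynomial (Fin n) ℂ)
    (hP : IsCovariantSymbol ε ⟨n - 1, by omega⟩ u v P)
    (hQ : IsCovariantSymbol ε ⟨n - 1, by omega⟩ u v Q) :
    ∃ a b : ℂ, ¬(a = 0 ∧ b = 0) ∧ a • P + b • Q = 0 := by
  obtain ⟨m₀, hm₀⟩ := rel_zero (u := u) (v := v) hε (i₀ := ⟨n - 1, by omega⟩) ⟨0, by omega⟩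
    ⟨1, by omega⟩ (by simp; omega) (by simp; omega) (by simp)
  have hdP := rel_of_cov hε hP
  have hdQ := rel_of_cov hε hQ
  have fin : ∀ a b : ℂ, a * Lam P (mon m₀) + b * Lam Q (mon m₀) = 0 → a • P + b • Q = 0 := by
    intro a b h
    have hz := hm₀ _ (hdP.comb hdQ a b) h
    ext m
    have := hz m
    simp only [Lam_monomial] at this
    have h3 : (a * coeff m P + b * coeff m Q) * NN m = 0 := by linear_combination this
    simpa [NN_ne] using h3
  by_cases h : Lam P (mon m₀) = 0
  · exact ⟨1, 0, by simp, fin 1 0 (by simp [h])⟩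
  · exact ⟨Lam Q (mon m₀), -Lam P (mon m₀), by simp [h], fin _ _ (by ring)⟩
end
end
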